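/- arXiv:1711.08332 — 2 statements merged into one kernel-verified Lean document; each statement's English description precedes it below -/
import Mathlib

section
/- Fix d \ge 1, T > 0, p \in [1,\infty], an integer r > 0, and \nu < 0 with \nu > -2(1 - 1/p). If \xi \in \mathcal{B}^{\nu,T}_p satisfies \langle\xi,\varphi\rangle = 0 for every test function \varphi supported in ((-\infty,0)\cup(0,T))\times\mathbb{R}^d, then \xi = 0, i.e., \langle\xi,\varphi\rangle = 0 for every test function \varphi supported in (-\infty,T)\times\mathbb{R}^d. -/
open MeasureTheory Filter Topology

noncomputable section

/-- Parabolic scaling exponents s = (2,1,…,1) on ℝ^(1+d). -/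
def sE (d : ℕ) : Fin (d + 1) → ℕ := Fin.cons 2 (fun _ => 1)

/-- Parabolically scaled norm |z|_s = max_i |z_i|^(1/s_i). -/
def snormE (d : ℕ) (z : Fin (d + 1) → ℝ) : ℝ := ⨆ i, |z i| ^ ((sE d i : ℝ)⁻¹)

/-- Scaling action l · z = (l^(s_i) z_i)_i. -/
def sclE (d : ℕ) (l : ℝ) (z : Fin (d + 1) → ℝ) : Fin (d + 1) → ℝ :=
  fun i => l ^ (sE d i) * z i

/-- Rescaled and recentred test function φ^λ_z(y) = λ^(-|s|) φ(λ⁻¹ · (y - z)),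
with |s| = d + 2. -/
def testScale (d : ℕ) (l : ℝ) (z : Fin (d + 1) → ℝ) (φ : (Fin (d + 1) → ℝ) → ℝ) :
    (Fin (d + 1) → ℝ) → ℝ :=
  fun y => (l ^ (d + 2))⁻¹ * φ (sclE d l⁻¹ (y - z))

/-- Scaled size |k|_s = ∑ s_i k_i of a multi-index. -/
def ksizeE (d : ℕ) (k : Fin (d + 1) → ℕ) : ℝ := ∑ i, (sE d i : ℝ) * (k i : ℝ)

/-- Partial derivative in direction i. -/
def pdE (d : ℕ) (i : Fin (d + 1)) (f : (Fin (d + 1) → ℝ) → ℝ) :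
    (Fin (d + 1) → ℝ) → ℝ :=
  fun z => fderiv ℝ f z (Pi.single i 1)

/-- Iterated partial derivative ∂^k. -/
def pdME (d : ℕ) (k : Fin (d + 1) → ℕ) (f : (Fin (d + 1) → ℝ) → ℝ) :
    (Fin (d + 1) → ℝ) → ℝ :=
  ((List.ofFn (fun i : Fin (d + 1) => (pdE d i)^[k i])).foldr (· ∘ ·) id) f

/-- The class 𝓑^r: C^r functions supported in the scaled unit ball whose scaled
derivatives of order < r are bounded by 1. -/
def BrSet (d r : ℕ) : Set ((Fin (d + 1) → ℝ) → ℝ) :=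
  {φ | tsupport φ ⊆ {y | snormE d y ≤ 1} ∧ ContDiff ℝ (r : ℕ∞) φ ∧
    ∀ k : Fin (d + 1) → ℕ, ksizeE d k < r → ∀ y, |pdME d k φ y| ≤ 1}

/-- A test function of class C^r, compactly supported, with support contained in S. -/
def IsTest (d r : ℕ) (S : Set (Fin (d + 1) → ℝ)) (φ : (Fin (d + 1) → ℝ) → ℝ) : Prop :=
  ContDiff ℝ (r : ℕ∞) φ ∧ HasCompactSupport φ ∧ tsupport φ ⊆ S

/-- ξ is linear on test functions supported in S. -/
def LinOn (d r : ℕ) (S : Set (Fin (d + 1) → ℝ))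
    (ξ : ((Fin (d + 1) → ℝ) → ℝ) → ℝ) : Prop :=
  (∀ φ ψ, IsTest d r S φ → IsTest d r S ψ → ξ (φ + ψ) = ξ φ + ξ ψ) ∧
  (∀ (c : ℝ) φ, IsTest d r S φ → ξ (c • φ) = c * ξ φ)

/-- ξ is periodic: invariant under integer translations in the space variables. -/
def PeriodicOn (d r : ℕ) (S : Set (Fin (d + 1) → ℝ))
    (ξ : ((Fin (d + 1) → ℝ) → ℝ) → ℝ) : Prop :=
  ∀ (m : Fin d → ℤ) (φ : (Fin (d + 1) → ℝ) → ℝ), IsTest d r S φ →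
    ξ (fun y => φ (y - Fin.cons (0 : ℝ) (fun i => (m i : ℝ)))) = ξ φ

/-- The strip I × 𝕋^d, realized as time coordinate in I and space coordinates in a
fundamental domain [0,1)^d. -/
def strip (d : ℕ) (I : Set ℝ) : Set (Fin (d + 1) → ℝ) :=
  {z | z 0 ∈ I ∧ ∀ i : Fin d, z i.succ ∈ Set.Ico (0 : ℝ) 1}

/-- L^p norm (p ∈ [1,∞]) of an ℝ≥0∞-valued function. -/
def lpE (d : ℕ) (μ : Measure (Fin (d + 1) → ℝ)) (p : ENNReal)
    (g : (Fin (d + 1) → ℝ) → ENNReal) : ENNReal :=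
  if p = ⊤ then essSup g μ else (∫⁻ z, g z ^ p.toReal ∂μ) ^ (1 / p.toReal)

/-- The region ((-∞,0) ∪ (0,T)) × ℝ^d. -/
def S0 (d : ℕ) (T : ℝ) : Set (Fin (d + 1) → ℝ) :=
  {z | z 0 < 0 ∨ (0 < z 0 ∧ z 0 < T)}

/-- The region (-∞,T) × ℝ^d. -/
def S1 (d : ℕ) (T : ℝ) : Set (Fin (d + 1) → ℝ) :=
  {z | z 0 < T}

/-- The weighted L^p quantity appearing in the definition of the space 𝓑^(ν,T)_p:
the L^p norm over z ∈ J × 𝕋^d of λ^(-ν) sup_(φ ∈ 𝓑^r) |ξ(φ^λ_z)|. -/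
def bNorm (d r : ℕ) (p : ENNReal) (ν : ℝ) (ξ : ((Fin (d + 1) → ℝ) → ℝ) → ℝ)
    (l : ℝ) (J : Set ℝ) : ENNReal :=
  lpE d (volume.restrict (strip d J)) p
    (fun z => ENNReal.ofReal (l ^ (-ν)) *
      ⨆ φ ∈ BrSet d r, ENNReal.ofReal |ξ (testScale d l z φ)|)

/-- Membership in 𝓑^(ν,T)_p (for ν < 0): periodicity together with finiteness of the
supremum over λ ∈ (0,1] of the weighted L^p norms over (-∞, T-λ²) × 𝕋^d. -/
def MemBnu (d r : ℕ) (p : ENNReal) (ν T : ℝ)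
    (ξ : ((Fin (d + 1) → ℝ) → ℝ) → ℝ) : Prop :=
  PeriodicOn d r (S1 d T) ξ ∧
  (⨆ l ∈ Set.Ioc (0 : ℝ) 1, bNorm d r p ν ξ l (Set.Iio (T - l ^ 2))) < ⊤

/-- `f` is `C^n` and all its derivatives up to order `n` are bounded by `C`. -/
def DerivBound {E : Type*} [NormedAddCommGroup E] [NormedSpace ℝ E] (n : ℕ) (C : ℝ)
    (f : E → ℝ) : Prop :=
  ContDiff ℝ n f ∧ ∀ m ≤ n, ∀ y, ‖iteratedFDeriv ℝ m f y‖ ≤ C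

lemma DerivBound.of_le {E : Type*} [NormedAddCommGroup E] [NormedSpace ℝ E] {n m : ℕ} {C : ℝ}
    {f : E → ℝ} (h : DerivBound n C f) (hm : m ≤ n) : DerivBound m C f :=
  ⟨h.1.of_le (by exact_mod_cast hm), fun k hk => h.2 k (hk.trans hm)⟩

lemma DerivBound.pdE {d n : ℕ} {C : ℝ} {f : (Fin (d + 1) → ℝ) → ℝ} (i : Fin (d + 1))
    (h : DerivBound (n + 1) C f) : DerivBound n C (pdE d i f) := by
  have hf : ContDiff ℝ n (fderiv ℝ f) := h.1.fderiv_right (by norm_cast)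
  refine ⟨hf.clm_apply contDiff_const, fun m hm y => ?_⟩
  have h1 := norm_iteratedFDeriv_clm_apply_const (c := (Pi.single i 1 : Fin (d + 1) → ℝ))
    (n := m) (hf.contDiffAt (x := y)) (by exact_mod_cast hm)
  rw [norm_iteratedFDeriv_fderiv, Pi.norm_single, norm_one, one_mul] at h1
  exact h1.trans (h.2 (m + 1) (by lia) y)

lemma DerivBound.pdE_iterate {d n : ℕ} {C : ℝ} (i : Fin (d + 1)) (k : ℕ) :
    ∀ {f : (Fin (d + 1) → ℝ) → ℝ}, DerivBound (n + k) C f →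
      DerivBound n C ((_root_.pdE d i)^[k] f) := by
  induction k with
  | zero => intro f h; exact h
  | succ k ih =>
    intro f h
    rw [Function.iterate_succ_apply]
    exact ih (DerivBound.pdE i h)

lemma DerivBound.foldr_pdE {d : ℕ} {C : ℝ} (k : Fin (d + 1) → ℕ) (l : List (Fin (d + 1))) :
    ∀ {n : ℕ} {f : (Fin (d + 1) → ℝ) → ℝ}, DerivBound (n + (l.map k).sum) C f →
      DerivBound n C (((l.map fun i => (_root_.pdE d i)^[k i]).foldr (· ∘ ·) id) f) := by
  induction l with
  | nil => intro n f h; exact h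
  | cons a l ih =>
    intro n f h
    rw [List.map_cons, List.sum_cons, ← add_assoc] at h
    exact DerivBound.pdE_iterate a (k a) (ih h)

lemma DerivBound.pdME {d r : ℕ} {C : ℝ} {f : (Fin (d + 1) → ℝ) → ℝ} (h : DerivBound r C f)
    {k : Fin (d + 1) → ℕ} (hk : ksizeE d k < r) (y : Fin (d + 1) → ℝ) :
    |pdME d k f y| ≤ C := by
  have hs : ((List.finRange (d + 1)).map k).sum ≤ r := by
    rw [← List.ofFn_eq_map, List.sum_ofFn]
    have h1 : ((∑ i, k i : ℕ) : ℝ) ≤ ksizeE d k := by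
      rw [ksizeE]
      push_cast
      refine Finset.sum_le_sum fun i _ => le_mul_of_one_le_left (by positivity) ?_
      refine Fin.cases ?_ (fun i => ?_) i <;> simp [sE]
    exact_mod_cast (h1.trans_lt hk).le
  have h2 := DerivBound.foldr_pdE k (List.finRange (d + 1)) (n := 0)
    (h.of_le (by rw [zero_add]; exact hs))
  rw [← List.ofFn_eq_map] at h2
  simpa [_root_.pdME] using h2.2 0 le_rfl y

lemma exists_derivBound_comp_affine {E : Type*} [NormedAddCommGroup E] [NormedSpace ℝ E]
    {r : ℕ} {f : E → ℝ} (hf : ContDiff ℝ r f) (hc : HasCompactSupport f) (K : ℝ) :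
    ∃ C : ℝ, 0 ≤ C ∧ ∀ (b : E) (L : E →L[ℝ] E), ‖L‖ ≤ K → DerivBound r C fun w => f (b + L w) := by
  have h1 : ∀ m : ℕ, ∃ C : ℝ, m ≤ r → ∀ y, ‖iteratedFDeriv ℝ m f y‖ ≤ C := by
    intro m
    by_cases hm : m ≤ r
    · obtain ⟨C, hC⟩ := (hc.iteratedFDeriv m).exists_bound_of_continuous
        (hf.continuous_iteratedFDeriv (by exact_mod_cast hm))
      exact ⟨C, fun _ => hC⟩
    · exact ⟨0, fun h => absurd h hm⟩
  choose C hC using h1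
  refine ⟨∑ m ∈ Finset.range (r + 1), |C m| * |K| ^ m, by positivity, fun b L hL => ?_⟩
  have hfb : ContDiff ℝ r fun w => f (b + w) := hf.comp (contDiff_const.add contDiff_id)
  refine ⟨hfb.comp L.contDiff, fun m hm y => ?_⟩
  have h2 := L.iteratedFDeriv_comp_right hfb y (i := m) (by exact_mod_cast hm)
  rw [iteratedFDeriv_comp_add_left] at h2
  change ‖iteratedFDeriv ℝ m ((fun w => f (b + w)) ∘ L) y‖ ≤ _
  rw [h2]
  refine (ContinuousMultilinearMap.norm_compContinuousLinearMap_le _ _).trans ?_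
  rw [Finset.prod_const, Finset.card_univ, Fintype.card_fin]
  refine le_trans ?_ (Finset.single_le_sum (f := fun m => |C m| * |K| ^ m)
    (fun _ _ => by positivity) (Finset.mem_range.2 (Nat.lt_succ_of_le hm)))
  have h3 := (hC m hm (b + L y)).trans (le_abs_self _)
  have h4 := hL.trans (le_abs_self _)
  gcongr

lemma DerivBound.mul {E : Type*} [NormedAddCommGroup E] [NormedSpace ℝ E]
    {r : ℕ} {f g : E → ℝ} {A B : ℝ} (hA : 0 ≤ A)
    (hf : DerivBound r A f) (hg : DerivBound r B g) :
    DerivBound r (2 ^ r * A * B) fun y => f y * g y := by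
  refine ⟨hf.1.mul hg.1, fun m hm y => ?_⟩
  have hB : 0 ≤ B := (norm_nonneg _).trans (hg.2 0 (Nat.zero_le _) y)
  refine (norm_iteratedFDeriv_mul_le hf.1 hg.1 y (by exact_mod_cast hm)).trans ?_
  calc _ ≤ ∑ i ∈ Finset.range (m + 1), (m.choose i : ℝ) * A * B := by
        refine Finset.sum_le_sum fun i hi => ?_
        have h1 := hf.2 i ((Nat.lt_succ_iff.1 (Finset.mem_range.1 hi)).trans hm) y
        have h2 := hg.2 (m - i) ((Nat.sub_le _ _).trans hm) y
        gcongr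
    _ = 2 ^ m * A * B := by
        rw [← Finset.sum_mul, ← Finset.sum_mul]
        norm_cast
        rw [Nat.sum_range_choose]
    _ ≤ _ := by
        gcongr
        norm_num

lemma DerivBound.const_smul {E : Type*} [NormedAddCommGroup E] [NormedSpace ℝ E]
    {r : ℕ} {f : E → ℝ} {A : ℝ} (c : ℝ) (hf : DerivBound r A f) :
    DerivBound r (|c| * A) (c • f) := by
  refine ⟨hf.1.const_smul c, fun m hm y => ?_⟩
  rw [iteratedFDeriv_const_smul_apply ((hf.1.of_le (by exact_mod_cast hm)).contDiffAt),
    norm_smul, Real.norm_eq_abs]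
  exact mul_le_mul_of_nonneg_left (hf.2 m hm y) (abs_nonneg c)

lemma DerivBound.mem_BrSet {d r : ℕ} {f : (Fin (d + 1) → ℝ) → ℝ} (hf : DerivBound r 1 f)
    (hs : ∀ w, f w ≠ 0 → ∀ i, |w i| ≤ 1) : f ∈ BrSet d r := by
  refine ⟨?_, hf.1, fun k hk y => hf.pdME hk y⟩
  have h1 : tsupport f ⊆ Metric.closedBall 0 1 := by
    refine closure_minimal (fun w hw => ?_) Metric.isClosed_closedBall
    rw [mem_closedBall_zero_iff, pi_norm_le_iff_of_nonneg zero_le_one]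
    exact hs w hw
  intro y hy
  have h2 := h1 hy
  rw [mem_closedBall_zero_iff, pi_norm_le_iff_of_nonneg zero_le_one] at h2
  exact ciSup_le fun i => Real.rpow_le_one (abs_nonneg _) (h2 i) (by positivity)

/-- A smooth bump supported in `[-1, 1]` whose integer translates sum to one. -/
def unitBump (s : ℝ) : ℝ := Real.smoothTransition (s + 1) - Real.smoothTransition s

/-- A smooth cutoff supported in `[-1, 1]`, equal to one on `[-1/2, 1/2]`. -/
def plateau (s : ℝ) : ℝ := Real.smoothTransition (2 + 2 * s) * Real.smoothTransition (2 - 2 * s)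

/-- Product of a plateau in time and unit bumps in space. -/
def cellCut (d : ℕ) (w : Fin (d + 1) → ℝ) : ℝ := plateau (w 0) * ∏ i : Fin d, unitBump (w i.succ)

/-- Localization of `φ` near the cell with index `j` of the parabolic grid of mesh `1 / N`. -/
def localize (d N : ℕ) (j : Fin d → ℤ) (φ : (Fin (d + 1) → ℝ) → ℝ) : (Fin (d + 1) → ℝ) → ℝ :=
  fun y => φ y * cellCut d (sclE d N y - Fin.cons (0 : ℝ) fun i => (j i : ℝ))

/-- The parabolic scaling as a continuous linear map. -/
def sclL (d : ℕ) (l : ℝ) : (Fin (d + 1) → ℝ) →L[ℝ] (Fin (d + 1) → ℝ) :=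
  ContinuousLinearMap.pi fun i => l ^ sE d i • ContinuousLinearMap.proj i

lemma sclL_apply (d : ℕ) (l : ℝ) (w : Fin (d + 1) → ℝ) : sclL d l w = sclE d l w := by
  ext i
  simp [sclL, sclE]

lemma norm_sclL_le (d : ℕ) {l K : ℝ} (hK : 0 ≤ K) (h : ∀ i, |l ^ sE d i| ≤ K) :
    ‖sclL d l‖ ≤ K := by
  refine ContinuousLinearMap.opNorm_le_bound _ hK fun w => ?_
  rw [sclL_apply, pi_norm_le_iff_of_nonneg (by positivity)]
  intro i
  rw [sclE, norm_mul, Real.norm_eq_abs]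
  exact mul_le_mul (h i) (norm_le_pi_norm w i) (norm_nonneg _) hK

lemma sclE_sclE (d : ℕ) (a b : ℝ) (w : Fin (d + 1) → ℝ) :
    sclE d a (sclE d b w) = sclE d (a * b) w := by
  ext i
  simp [sclE, mul_pow, mul_assoc]

lemma sclE_one (d : ℕ) (w : Fin (d + 1) → ℝ) : sclE d 1 w = w := by
  ext i
  simp [sclE]

lemma sclE_sub (d : ℕ) (a : ℝ) (v w : Fin (d + 1) → ℝ) :
    sclE d a (v - w) = sclE d a v - sclE d a w := by
  ext i
  simp [sclE, mul_sub]

lemma unitBump_contDiff {n : ℕ} : ContDiff ℝ n unitBump := by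
  have h : ContDiff ℝ n Real.smoothTransition := by
    exact_mod_cast Real.smoothTransition.contDiff (n := (n : ℕ∞))
  exact (h.comp (contDiff_id.add contDiff_const)).sub h

lemma plateau_contDiff {n : ℕ} : ContDiff ℝ n plateau := by
  have h : ContDiff ℝ n Real.smoothTransition := by
    exact_mod_cast Real.smoothTransition.contDiff (n := (n : ℕ∞))
  exact (h.comp (contDiff_const.add (contDiff_const.mul contDiff_id))).mul
    (h.comp (contDiff_const.sub (contDiff_const.mul contDiff_id)))

lemma abs_le_one_of_unitBump_ne_zero {s : ℝ} (h : unitBump s ≠ 0) : |s| ≤ 1 := by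
  contrapose! h
  rcases lt_abs.1 h with h | h
  · rw [unitBump, Real.smoothTransition.one_of_one_le (by linarith),
      Real.smoothTransition.one_of_one_le h.le, sub_self]
  · rw [unitBump, Real.smoothTransition.zero_of_nonpos (by linarith),
      Real.smoothTransition.zero_of_nonpos (by linarith), sub_self]

lemma abs_le_one_of_plateau_ne_zero {s : ℝ} (h : plateau s ≠ 0) : |s| ≤ 1 := by
  contrapose! h
  rcases lt_abs.1 h with h | h
  · rw [plateau, Real.smoothTransition.zero_of_nonpos (x := 2 - 2 * s) (by linarith), mul_zero]
  · rw [plateau, Real.smoothTransition.zero_of_nonpos (x := 2 + 2 * s) (by linarith), zero_mul]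

lemma plateau_eq_one {s : ℝ} (h : |s| ≤ 1 / 2) : plateau s = 1 := by
  have := abs_le.1 h
  rw [plateau, Real.smoothTransition.one_of_one_le (by linarith),
    Real.smoothTransition.one_of_one_le (by linarith), one_mul]

lemma cellCut_contDiff (d : ℕ) {n : ℕ} : ContDiff ℝ n (cellCut d) :=
  (plateau_contDiff.comp (contDiff_apply ℝ ℝ (0 : Fin (d + 1)))).mul
    (contDiff_prod fun i _ => unitBump_contDiff.comp (contDiff_apply ℝ ℝ i.succ))

lemma abs_le_one_of_cellCut_ne_zero {d : ℕ} {w : Fin (d + 1) → ℝ} (h : cellCut d w ≠ 0)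
    (i : Fin (d + 1)) : |w i| ≤ 1 := by
  refine Fin.cases (abs_le_one_of_plateau_ne_zero (left_ne_zero_of_mul h)) (fun i => ?_) i
  exact abs_le_one_of_unitBump_ne_zero
    (Finset.prod_ne_zero_iff.1 (right_ne_zero_of_mul h) i (Finset.mem_univ i))

lemma cellCut_hasCompactSupport (d : ℕ) : HasCompactSupport (cellCut d) := by
  refine HasCompactSupport.intro (isCompact_closedBall (0 : Fin (d + 1) → ℝ) 1) fun w hw => ?_
  contrapose! hw
  rw [mem_closedBall_zero_iff, pi_norm_le_iff_of_nonneg zero_le_one]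
  exact abs_le_one_of_cellCut_ne_zero hw

lemma IsTest.mul_right {d r : ℕ} {S : Set (Fin (d + 1) → ℝ)} {φ η : (Fin (d + 1) → ℝ) → ℝ}
    (h : IsTest d r S φ) (hη : ContDiff ℝ r η) : IsTest d r S fun y => φ y * η y :=
  ⟨h.1.mul hη, h.2.1.mul_right, (tsupport_mul_subset_left (f := φ)).trans h.2.2⟩

lemma contDiff_sclE (d : ℕ) (l : ℝ) {n : ℕ} : ContDiff ℝ n (sclE d l) := by
  have h := (sclL d l).contDiff (n := n)
  rwa [show ⇑(sclL d l) = sclE d l from funext (sclL_apply d l)] at h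

lemma IsTest.localize {d r : ℕ} {S : Set (Fin (d + 1) → ℝ)} {φ : (Fin (d + 1) → ℝ) → ℝ}
    (h : IsTest d r S φ) (N : ℕ) (j : Fin d → ℤ) : IsTest d r S (localize d N j φ) :=
  h.mul_right ((cellCut_contDiff d).comp ((contDiff_sclE d N).sub contDiff_const))

lemma exists_localize_le_iSup {d r : ℕ} {S : Set (Fin (d + 1) → ℝ)}
    {ξ : ((Fin (d + 1) → ℝ) → ℝ) → ℝ} (hlin : LinOn d r S ξ)
    {φ : (Fin (d + 1) → ℝ) → ℝ} (hφ : IsTest d r S φ) :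
    ∃ A : ℝ, 0 < A ∧ ∀ N : ℕ, 2 ≤ N → ∀ (j : Fin d → ℤ) (z : Fin (d + 1) → ℝ),
      (N : ℝ) ^ 2 * z 0 ∈ Set.Ico (0 : ℝ) 1 → (∀ i : Fin d, ⌊(N : ℝ) * z i.succ⌋ = j i) →
      ENNReal.ofReal ((A * (2 / N : ℝ) ^ (d + 2))⁻¹ * |ξ (localize d N j φ)|) ≤
        ⨆ ψ ∈ BrSet d r, ENNReal.ofReal |ξ (testScale d (2 / N) z ψ)| := by
  obtain ⟨A₁, hA₁, h1⟩ := exists_derivBound_comp_affine (r := r) (by exact_mod_cast hφ.1) hφ.2.1 1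
  obtain ⟨A₂, hA₂, h2⟩ := exists_derivBound_comp_affine (r := r) (cellCut_contDiff d)
    (cellCut_hasCompactSupport d) 4
  refine ⟨2 ^ r * A₁ * A₂ + 1, by positivity, fun N hN j z hz0 hz => ?_⟩
  set A := 2 ^ r * A₁ * A₂ + 1 with hA
  have hApos : 0 < A := by positivity
  have hN' : (2 : ℝ) ≤ N := by exact_mod_cast hN
  have hNpos : (0 : ℝ) < N := by linarith
  set l : ℝ := 2 / N with hl
  have hlpos : 0 < l := by positivity
  have hl1 : l ≤ 1 := (div_le_one hNpos).2 hN'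
  set b : Fin (d + 1) → ℝ := sclE d N z - Fin.cons (0 : ℝ) fun i => (j i : ℝ) with hb
  set g : (Fin (d + 1) → ℝ) → ℝ :=
    fun w => φ (z + sclL d l w) * cellCut d (b + sclL d 2 w) with hg
  have hgb : DerivBound r (2 ^ r * A₁ * A₂) g := by
    refine (h1 z _ (norm_sclL_le d zero_le_one fun i => ?_)).mul hA₁
      (h2 b _ (norm_sclL_le d (by norm_num) fun i => ?_))
    · rw [abs_of_pos (by positivity)]
      exact pow_le_one₀ hlpos.le hl1
    · refine Fin.cases ?_ (fun i => ?_) i <;> simp [sE] <;> norm_num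
  have hmem : A⁻¹ • g ∈ BrSet d r := by
    refine DerivBound.mem_BrSet ⟨(hgb.const_smul A⁻¹).1, fun m hm y => ?_⟩ fun w hw i => ?_
    · refine ((hgb.const_smul A⁻¹).2 m hm y).trans ?_
      rw [abs_of_pos (inv_pos.2 hApos), inv_mul_le_one₀ hApos]
      linarith
    · have h3 : cellCut d (b + sclL d 2 w) ≠ 0 := by
        intro h
        simp [hg, h] at hw
      have h4 := abs_le_one_of_cellCut_ne_zero h3
      rw [sclL_apply, hb] at h4
      refine Fin.cases ?_ (fun i => ?_) i
      · have h5 := abs_le.1 (h4 0)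
        simp only [Pi.add_apply, Pi.sub_apply, sclE, sE, Fin.cons_zero] at h5
        obtain ⟨h6, h7⟩ := hz0
        rw [abs_le]
        constructor <;> linarith
      · have h5 := abs_le.1 (h4 i.succ)
        simp only [Pi.add_apply, Pi.sub_apply, sclE, sE, Fin.cons_succ, pow_one] at h5
        obtain ⟨h6, h7⟩ := Int.floor_eq_iff.1 (hz i)
        rw [abs_le]
        constructor <;> linarith
  have hscale : testScale d l z (A⁻¹ • g) = (A * l ^ (d + 2))⁻¹ • localize d N j φ := by
    ext y
    have h3 : l * l⁻¹ = 1 := mul_inv_cancel₀ hlpos.ne'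
    have h4 : 2 * l⁻¹ = N := by
      rw [hl]
      field_simp
    have h5 : b + (sclE d N y - sclE d N z) =
        sclE d N y - Fin.cons (0 : ℝ) fun i => (j i : ℝ) := by
      rw [hb]
      abel
    simp only [testScale, Pi.smul_apply, smul_eq_mul, hg, sclL_apply, sclE_sclE, h3, h4,
      sclE_one, add_sub_cancel, sclE_sub d N, h5, localize]
    rw [mul_inv]
    ring
  refine le_trans (le_of_eq ?_) (le_iSup₂ (A⁻¹ • g) hmem)
  rw [hscale, hlin.2 _ _ (hφ.localize N j), abs_mul,
    abs_of_pos (show 0 < (A * l ^ (d + 2))⁻¹ by positivity)]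

/-- The cell with index `j` of the parabolic grid of mesh `1 / N` in the first time layer. -/
def gridCell (d N : ℕ) (j : Fin d → ℤ) : Set (Fin (d + 1) → ℝ) :=
  {z | (N : ℝ) ^ 2 * z 0 ∈ Set.Ico (0 : ℝ) 1 ∧ ∀ i : Fin d, ⌊(N : ℝ) * z i.succ⌋ = j i}

lemma gridCell_eq_pi {d N : ℕ} (hN : 0 < N) (j : Fin d → ℤ) :
    gridCell d N j = Set.univ.pi fun i =>
      Set.Ico ((Fin.cons 0 fun i => (j i : ℝ) / N : Fin (d + 1) → ℝ) i)
        ((Fin.cons ((N : ℝ)⁻¹ ^ 2) fun i => ((j i : ℝ) + 1) / N : Fin (d + 1) → ℝ) i) := by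
  have hN' : (0 : ℝ) < N := by exact_mod_cast hN
  ext z
  simp only [gridCell, Set.mem_ofPred_eq, Set.mem_univ_pi, Fin.forall_fin_succ, Fin.cons_zero,
    Fin.cons_succ, Set.mem_Ico, Int.floor_eq_iff]
  refine and_congr (and_congr ?_ ?_) (forall_congr' fun i => and_congr ?_ ?_)
  · exact mul_nonneg_iff_of_pos_left (by positivity)
  · rw [inv_pow, ← one_div, lt_div_iff₀ (by positivity), mul_comm]
  · rw [div_le_iff₀ hN', mul_comm]
  · rw [lt_div_iff₀ hN', mul_comm]

lemma measurableSet_gridCell {d N : ℕ} (hN : 0 < N) (j : Fin d → ℤ) :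
    MeasurableSet (gridCell d N j) := by
  rw [gridCell_eq_pi hN]
  exact MeasurableSet.univ_pi fun i => measurableSet_Ico

lemma volume_gridCell {d N : ℕ} (hN : 0 < N) (j : Fin d → ℤ) :
    volume (gridCell d N j) = ENNReal.ofReal ((N : ℝ)⁻¹ ^ (d + 2)) := by
  have hN' : (0 : ℝ) < N := by exact_mod_cast hN
  rw [gridCell_eq_pi hN, Real.volume_pi_Ico, Fin.prod_univ_succ]
  simp only [Fin.cons_zero, Fin.cons_succ, sub_zero, ← sub_div, add_sub_cancel_left, one_div,
    Finset.prod_const, Finset.card_univ, Fintype.card_fin]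
  rw [← ENNReal.ofReal_pow (by positivity), ← ENNReal.ofReal_mul (by positivity), ← pow_add,
    add_comm]

lemma strip_Ico_eq_pi (d : ℕ) (a b : ℝ) :
    strip d (Set.Ico a b) = Set.univ.pi fun i =>
      Set.Ico ((Fin.cons a fun _ => 0 : Fin (d + 1) → ℝ) i)
        ((Fin.cons b fun _ => 1 : Fin (d + 1) → ℝ) i) := by
  ext z
  simp [strip, Fin.forall_fin_succ]

lemma volume_strip_Ico (d : ℕ) (b : ℝ) :
    volume (strip d (Set.Ico 0 b)) = ENNReal.ofReal b := by
  rw [strip_Ico_eq_pi, Real.volume_pi_Ico, Fin.prod_univ_succ]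
  simp

lemma measurableSet_strip_Ico (d : ℕ) (a b : ℝ) : MeasurableSet (strip d (Set.Ico a b)) := by
  rw [strip_Ico_eq_pi]
  exact MeasurableSet.univ_pi fun i => measurableSet_Ico

lemma gridCell_subset_strip {d N : ℕ} (hN : 0 < N) (j : Fin d → Fin N) :
    gridCell d N (fun i => ((j i : ℕ) : ℤ)) ⊆ strip d (Set.Ico 0 ((N : ℝ)⁻¹ ^ 2)) := by
  have hN' : (0 : ℝ) < N := by exact_mod_cast hN
  rw [gridCell_eq_pi hN, strip_Ico_eq_pi]
  refine Set.pi_mono fun i _ => Set.Ico_subset_Ico ?_ ?_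
  · refine Fin.cases ?_ (fun i => ?_) i
    · simp
    · simp only [Fin.cons_succ]
      positivity
  · refine Fin.cases ?_ (fun i => ?_) i
    · simp
    · simp only [Fin.cons_succ]
      rw [div_le_one hN']
      exact_mod_cast (j i).2

lemma lpE_eq_eLpNorm {d : ℕ} (μ : Measure (Fin (d + 1) → ℝ)) {p : ENNReal} (hp : 1 ≤ p)
    (g : (Fin (d + 1) → ℝ) → ENNReal) : lpE d μ p g = eLpNorm g p μ := by
  have hp0 : p ≠ 0 := (zero_lt_one.trans_le hp).ne'
  rw [lpE]
  split_ifs with h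
  · rw [h, eLpNorm_exponent_top, eLpNormEssSup]
    rfl
  · rw [eLpNorm_eq_lintegral_rpow_enorm_toReal hp0 h]
    rfl

/-- The Hölder inequality for a step function on the first time layer of the grid. -/
lemma sum_gridCell_le {d N : ℕ} (hN : 0 < N) {p : ENNReal} (hp : 1 ≤ p)
    (a : (Fin d → ℤ) → ENNReal) (F : (Fin (d + 1) → ℝ) → ENNReal)
    (hF : ∀ j, ∀ z ∈ gridCell d N j, a j ≤ F z) {J : Set ℝ}
    (hJ : Set.Ico 0 ((N : ℝ)⁻¹ ^ 2) ⊆ J) :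
    ∑ j : Fin d → Fin N, a (fun i => ((j i : ℕ) : ℤ)) * ENNReal.ofReal ((N : ℝ)⁻¹ ^ (d + 2)) ≤
      lpE d (volume.restrict (strip d J)) p F *
        ENNReal.ofReal ((N : ℝ)⁻¹ ^ 2) ^ (1 - 1 / p).toReal := by
  have hN' : (0 : ℝ) < N := by exact_mod_cast hN
  set B := strip d (Set.Ico 0 ((N : ℝ)⁻¹ ^ 2)) with hB
  set G : (Fin (d + 1) → ℝ) → ENNReal := fun z => a fun i => ⌊(N : ℝ) * z i.succ⌋ with hG
  have hGm : Measurable G :=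
    (Measurable.of_discrete (f := a)).comp (measurable_pi_lambda _ fun i =>
      Int.measurable_floor.comp ((measurable_pi_apply i.succ).const_mul _))
  have hBm : MeasurableSet B := measurableSet_strip_Ico d _ _
  have hBJ : B ⊆ strip d J := fun z hz => ⟨hJ hz.1, hz.2⟩
  have hdisj : Pairwise fun j j' : Fin d → Fin N =>
      Disjoint (gridCell d N fun i => ((j i : ℕ) : ℤ)) (gridCell d N fun i => ((j' i : ℕ) : ℤ)) := by
    intro j j' hjj
    refine Set.disjoint_left.2 fun z hz hz' => hjj ?_
    ext i
    have h := (hz.2 i).symm.trans (hz'.2 i)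
    exact Int.ofNat.inj h
  calc _ = ∑ j : Fin d → Fin N, ∫⁻ z in gridCell d N fun i => ((j i : ℕ) : ℤ), G z := by
        refine Finset.sum_congr rfl fun j _ => ?_
        rw [← volume_gridCell hN fun i => ((j i : ℕ) : ℤ), ← setLIntegral_const]
        refine setLIntegral_congr_fun (measurableSet_gridCell hN _) fun z hz => ?_
        simp only [hG, hz.2]
    _ = ∫⁻ z in ⋃ j ∈ (Finset.univ : Finset (Fin d → Fin N)),
          gridCell d N fun i => ((j i : ℕ) : ℤ), G z :=
        (lintegral_biUnion_finset (fun j _ j' _ h => hdisj h)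
          (fun j _ => measurableSet_gridCell hN _) G).symm
    _ ≤ ∫⁻ z in B, G z :=
        lintegral_mono_set (Set.iUnion₂_subset fun j _ => gridCell_subset_strip hN j)
    _ = eLpNorm G 1 (volume.restrict B) := by
        rw [eLpNorm_one_eq_lintegral_enorm]
        rfl
    _ ≤ eLpNorm G p (volume.restrict B) *
          (volume.restrict B) Set.univ ^ (1 / (1 : ENNReal).toReal - 1 / p.toReal) :=
        eLpNorm_le_eLpNorm_mul_rpow_measure_univ hp hGm.aestronglyMeasurable
    _ ≤ _ := by
        have h1 : 1 / (1 : ENNReal).toReal - 1 / p.toReal = (1 - 1 / p).toReal := by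
          rw [ENNReal.toReal_sub_of_le (by simpa using hp) ENNReal.one_ne_top]
          simp
        rw [h1, Measure.restrict_apply_univ, hB, volume_strip_Ico, ← hB, lpE_eq_eLpNorm _ hp]
        gcongr
        calc eLpNorm G p (volume.restrict B) ≤ eLpNorm F p (volume.restrict B) := by
              refine eLpNorm_mono_enorm_ae ?_
              filter_upwards [ae_restrict_mem hBm] with z hz
              refine hF _ z ⟨⟨?_, ?_⟩, fun i => rfl⟩
              · exact mul_nonneg (by positivity) hz.1.1
              · have h2 := hz.1.2
                rw [inv_pow, ← one_div, lt_div_iff₀ (by positivity)] at h2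
                linarith
          _ ≤ _ := eLpNorm_mono_measure _ (Measure.restrict_mono hBJ le_rfl)

lemma exists_sum_localize_le {d r : ℕ} {T : ℝ} (hT : 0 < T) {p : ENNReal} (hp : 1 ≤ p) {ν : ℝ}
    {ξ : ((Fin (d + 1) → ℝ) → ℝ) → ℝ} (hlin : LinOn d r (S1 d T) ξ)
    (hmem : MemBnu d r p ν T ξ) {φ : (Fin (d + 1) → ℝ) → ℝ} (hφ : IsTest d r (S1 d T) φ) :
    ∃ C : ℝ, ∀ᶠ N : ℕ in atTop,
      ∑ j : Fin d → Fin N, |ξ (localize d N (fun i => ((j i : ℕ) : ℤ)) φ)| ≤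
        C * (N : ℝ)⁻¹ ^ (2 * (1 - 1 / p).toReal + ν) := by
  obtain ⟨A, hA, hbound⟩ := exists_localize_le_iSup hlin hφ
  obtain ⟨-, hM⟩ := hmem
  set M := ⨆ l ∈ Set.Ioc (0 : ℝ) 1, bNorm d r p ν ξ l (Set.Iio (T - l ^ 2)) with hMdef
  set κ := (1 - 1 / p).toReal with hκ
  have hκ0 : 0 ≤ κ := ENNReal.toReal_nonneg
  refine ⟨M.toReal * A * 2 ^ (d + 2) * 2 ^ ν, ?_⟩
  have hev : ∀ᶠ N : ℕ in atTop, 5 * (N : ℝ)⁻¹ ^ 2 < T := by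
    have h : Tendsto (fun N : ℕ => 5 * (N : ℝ)⁻¹ ^ 2) atTop (𝓝 (5 * 0 ^ 2)) :=
      (tendsto_natCast_atTop_atTop.inv_tendsto_atTop.pow 2).const_mul 5
    exact h.eventually_lt_const (by simpa using hT)
  filter_upwards [hev, eventually_ge_atTop 2] with N hNT hN
  have hN' : (2 : ℝ) ≤ N := by exact_mod_cast hN
  have hNpos : (0 : ℝ) < N := by linarith
  set ε : ℝ := (N : ℝ)⁻¹ with hε
  have hεpos : 0 < ε := by positivity
  have hl : (2 / N : ℝ) = 2 * ε := div_eq_mul_inv _ _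
  have hl1 : 2 * ε ≤ 1 := hl ▸ (div_le_one hNpos).2 hN'
  set c : (Fin d → ℤ) → ℝ := fun j =>
    (2 * ε) ^ (-ν) * ((A * (2 * ε) ^ (d + 2))⁻¹ * |ξ (localize d N j φ)|) with hc
  have hc0 : ∀ j, 0 ≤ c j := fun j => by positivity
  have h1 := sum_gridCell_le (d := d) (N := N) (by lia) hp (fun j => ENNReal.ofReal (c j))
    (fun z => ENNReal.ofReal ((2 * ε) ^ (-ν)) *
      ⨆ ψ ∈ BrSet d r, ENNReal.ofReal |ξ (testScale d (2 * ε) z ψ)|)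
    (fun j z hz => by
      rw [hc, ENNReal.ofReal_mul (by positivity), ← hl]
      gcongr
      exact hbound N hN j z hz.1 hz.2)
    (J := Set.Iio (T - (2 * ε) ^ 2))
    (fun t ht => by
      have := ht.2
      simp only [Set.mem_Iio]
      linarith)
  have h2 : bNorm d r p ν ξ (2 * ε) (Set.Iio (T - (2 * ε) ^ 2)) ≤ M :=
    le_iSup₂ (f := fun l (_ : l ∈ Set.Ioc (0 : ℝ) 1) => bNorm d r p ν ξ l (Set.Iio (T - l ^ 2)))
      (2 * ε) ⟨by positivity, hl1⟩
  have h3 := h1.trans (mul_le_mul_left h2 _)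
  have h4 : ∑ j : Fin d → Fin N, c (fun i => ((j i : ℕ) : ℤ)) * ε ^ (d + 2) ≤
      M.toReal * (ε ^ 2) ^ κ := by
    rw [← ENNReal.ofReal_toReal hM.ne, ENNReal.ofReal_rpow_of_nonneg (by positivity) hκ0,
      ← ENNReal.ofReal_mul ENNReal.toReal_nonneg] at h3
    rw [← ENNReal.ofReal_le_ofReal_iff (by positivity), ENNReal.ofReal_sum_of_nonneg
      (fun j _ => mul_nonneg (hc0 _) (by positivity))]
    refine le_of_eq_of_le (Finset.sum_congr rfl fun j _ => ?_) h3
    rw [ENNReal.ofReal_mul (hc0 _)]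
  have h5 : ∀ x : ℝ, x = (A * 2 ^ (d + 2) * 2 ^ ν * ε ^ ν) *
      ((2 * ε) ^ (-ν) * ((A * (2 * ε) ^ (d + 2))⁻¹ * x) * ε ^ (d + 2)) := by
    intro x
    rw [Real.rpow_neg (by positivity), Real.mul_rpow (by norm_num) hεpos.le, mul_pow]
    have := Real.rpow_pos_of_pos hεpos ν
    have := Real.rpow_pos_of_pos (zero_lt_two (α := ℝ)) ν
    field_simp
  calc _ = (A * 2 ^ (d + 2) * 2 ^ ν * ε ^ ν) *
        ∑ j : Fin d → Fin N, c (fun i => ((j i : ℕ) : ℤ)) * ε ^ (d + 2) := by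
        rw [Finset.mul_sum]
        exact Finset.sum_congr rfl fun j _ => h5 _
    _ ≤ (A * 2 ^ (d + 2) * 2 ^ ν * ε ^ ν) * (M.toReal * (ε ^ 2) ^ κ) := by gcongr
    _ = _ := by
        rw [Real.rpow_add hεpos, Real.rpow_mul hεpos.le, Real.rpow_two]
        ring

lemma sum_unitBump (N : ℕ) (s : ℝ) :
    ∑ j : Fin N, unitBump (s - (j : ℕ)) =
      Real.smoothTransition (s + 1) - Real.smoothTransition (s - N + 1) := by
  rw [Fin.sum_univ_eq_sum_range fun j => unitBump (s - (j : ℕ))]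
  have h := Finset.sum_range_sub' (fun j : ℕ => Real.smoothTransition (s - j + 1)) N
  rw [Nat.cast_zero, sub_zero] at h
  rw [← h]
  refine Finset.sum_congr rfl fun j _ => ?_
  rw [unitBump]
  push_cast
  ring_nf

lemma sum_sum_unitBump {N R : ℕ} (hN : 0 < N) {x : ℝ} (hx : |x| ≤ R - 1) :
    ∑ m : Fin (2 * R), ∑ j : Fin N, unitBump (N * (x - (((m : ℕ) : ℝ) - R)) - (j : ℕ)) = 1 := by
  have hN' : (1 : ℝ) ≤ N := by exact_mod_cast hN
  obtain ⟨h1, h2⟩ := abs_le.1 hx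
  simp_rw [sum_unitBump]
  rw [Fin.sum_univ_eq_sum_range fun m => Real.smoothTransition (N * (x - (((m : ℕ) : ℝ) - R)) + 1) -
    Real.smoothTransition (N * (x - (((m : ℕ) : ℝ) - R)) - N + 1)]
  have h := Finset.sum_range_sub'
    (fun m : ℕ => Real.smoothTransition (N * (x - ((m : ℝ) - R)) + 1)) (2 * R)
  rw [Real.smoothTransition.one_of_one_le (x := N * (x - (((0 : ℕ) : ℝ) - R)) + 1)
      (by push_cast; nlinarith),
    Real.smoothTransition.zero_of_nonpos (by push_cast; nlinarith), sub_zero] at h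
  refine (Finset.sum_congr rfl fun m _ => ?_).trans h
  push_cast
  ring_nf

lemma sum_sum_cellCut {d N R : ℕ} (hN : 0 < N) {y : Fin (d + 1) → ℝ}
    (hy : ∀ i : Fin d, |y i.succ| ≤ R - 1) :
    ∑ m : Fin d → Fin (2 * R), ∑ j : Fin d → Fin N,
      cellCut d (sclE d N (y - Fin.cons (0 : ℝ) fun i => ((((m i : ℕ) : ℤ) - R : ℤ) : ℝ)) -
        Fin.cons (0 : ℝ) fun i => (((j i : ℕ) : ℤ) : ℝ)) = plateau ((N : ℝ) ^ 2 * y 0) := by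
  simp only [cellCut, Pi.sub_apply, sclE, sE, Fin.cons_zero, Fin.cons_succ, sub_zero, pow_one,
    ← Finset.mul_sum]
  push_cast
  have h1 : ∀ m : Fin d → Fin (2 * R), ∑ j : Fin d → Fin N, ∏ i,
      unitBump (N * (y i.succ - (((m i : ℕ) : ℝ) - R)) - ((j i : ℕ) : ℝ)) =
      ∏ i, ∑ j : Fin N, unitBump (N * (y i.succ - (((m i : ℕ) : ℝ) - R)) - (j : ℕ)) := by
    intro m
    rw [Finset.prod_univ_sum, Fintype.piFinset_univ]
  simp_rw [h1]
  have h2 := Finset.prod_univ_sum (fun _ : Fin d => (Finset.univ : Finset (Fin (2 * R))))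
    (fun i m => ∑ j : Fin N, unitBump (N * (y i.succ - (((m : ℕ) : ℝ) - R)) - (j : ℕ)))
  rw [Fintype.piFinset_univ] at h2
  rw [← h2, Finset.prod_eq_one fun i _ => sum_sum_unitBump hN (hy i), mul_one]

lemma IsTest.zero (d r : ℕ) (S : Set (Fin (d + 1) → ℝ)) : IsTest d r S 0 := by
  refine ⟨contDiff_const, HasCompactSupport.zero, ?_⟩
  rw [tsupport_eq_empty_iff.2 rfl]
  exact Set.empty_subset S

lemma IsTest.add {d r : ℕ} {S : Set (Fin (d + 1) → ℝ)} {φ ψ : (Fin (d + 1) → ℝ) → ℝ}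
    (hφ : IsTest d r S φ) (hψ : IsTest d r S ψ) : IsTest d r S (φ + ψ) :=
  ⟨hφ.1.add hψ.1, hφ.2.1.add hψ.2.1,
    (tsupport_add φ ψ).trans (Set.union_subset hφ.2.2 hψ.2.2)⟩

lemma LinOn.map_sum {d r : ℕ} {S : Set (Fin (d + 1) → ℝ)} {ξ : ((Fin (d + 1) → ℝ) → ℝ) → ℝ}
    (hlin : LinOn d r S ξ) {ι : Type*} (s : Finset ι) (f : ι → (Fin (d + 1) → ℝ) → ℝ)
    (hf : ∀ i ∈ s, IsTest d r S (f i)) :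
    IsTest d r S (∑ i ∈ s, f i) ∧ ξ (∑ i ∈ s, f i) = ∑ i ∈ s, ξ (f i) := by
  classical
  induction s using Finset.induction_on with
  | empty =>
    refine ⟨IsTest.zero d r S, ?_⟩
    have h := hlin.2 0 0 (IsTest.zero d r S)
    simpa using h
  | insert a s ha ih =>
    obtain ⟨h1, h2⟩ := ih fun i hi => hf i (Finset.mem_insert_of_mem hi)
    have h3 := hf a (Finset.mem_insert_self a s)
    rw [Finset.sum_insert ha, Finset.sum_insert ha, hlin.1 _ _ h3 h1, h2]
    exact ⟨h3.add h1, rfl⟩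

lemma IsTest.translate {d r : ℕ} {T : ℝ} {φ : (Fin (d + 1) → ℝ) → ℝ}
    (h : IsTest d r (S1 d T) φ) {v : Fin (d + 1) → ℝ} (hv : v 0 = 0) :
    IsTest d r (S1 d T) fun y => φ (y + v) := by
  refine ⟨h.1.comp (contDiff_id.add contDiff_const),
    h.2.1.comp_homeomorph (Homeomorph.addRight v), ?_⟩
  intro y hy
  have h1 : y + v ∈ tsupport φ :=
    tsupport_comp_subset_preimage φ (f := fun y => y + v) (by fun_prop) hy
  have h2 := h.2.2 h1
  simpa [S1, hv] using h2

/-- The functional only sees the part of a test function near the hyperplane of time zero. -/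
lemma eq_mul_plateau {d r N : ℕ} {T : ℝ} {ξ : ((Fin (d + 1) → ℝ) → ℝ) → ℝ} (hN : 0 < N)
    (hlin : LinOn d r (S1 d T) ξ)
    (hzero : ∀ φ, IsTest d r (S1 d T) φ → tsupport φ ⊆ S0 d T → ξ φ = 0)
    {φ : (Fin (d + 1) → ℝ) → ℝ} (hφ : IsTest d r (S1 d T) φ) :
    ξ φ = ξ fun y => φ y * plateau ((N : ℝ) ^ 2 * y 0) := by
  have hN' : (0 : ℝ) < N := by exact_mod_cast hN
  have hχ : ContDiff ℝ r fun y : Fin (d + 1) → ℝ => plateau ((N : ℝ) ^ 2 * y 0) :=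
    plateau_contDiff.comp (contDiff_const.mul (contDiff_apply ℝ ℝ 0))
  have h1 := hφ.mul_right hχ
  have h2 : IsTest d r (S1 d T) fun y => φ y * (1 - plateau ((N : ℝ) ^ 2 * y 0)) :=
    hφ.mul_right (contDiff_const.sub hχ)
  have h3 : ξ (fun y => φ y * (1 - plateau ((N : ℝ) ^ 2 * y 0))) = 0 := by
    refine hzero _ h2 fun y hy => ?_
    have hT : y 0 < T := h2.2.2 hy
    have hclosed : IsClosed {y : Fin (d + 1) → ℝ | 1 / 2 ≤ |(N : ℝ) ^ 2 * y 0|} :=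
      isClosed_le continuous_const (by fun_prop)
    have h4 : y ∈ {y : Fin (d + 1) → ℝ | 1 / 2 ≤ |(N : ℝ) ^ 2 * y 0|} := by
      refine closure_minimal (fun w hw => ?_) hclosed hy
      by_contra hw'
      simp only [Set.mem_ofPred_eq, not_le] at hw'
      exact hw (by simp [plateau_eq_one hw'.le])
    rcases lt_trichotomy (y 0) 0 with h | h | h
    · exact Or.inl h
    · norm_num [h] at h4
    · exact Or.inr ⟨h, hT⟩
  have h5 := hlin.1 _ _ h1 h2
  rw [h3, add_zero] at h5
  rw [← h5]
  congr 1
  ext y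
  simp only [Pi.add_apply]
  ring

lemma abs_le_sum_localize {d r N R : ℕ} {T : ℝ} {ξ : ((Fin (d + 1) → ℝ) → ℝ) → ℝ} (hN : 0 < N)
    (hlin : LinOn d r (S1 d T) ξ) (hper : PeriodicOn d r (S1 d T) ξ)
    (hzero : ∀ φ, IsTest d r (S1 d T) φ → tsupport φ ⊆ S0 d T → ξ φ = 0)
    {φ : (Fin (d + 1) → ℝ) → ℝ} (hφ : IsTest d r (S1 d T) φ)
    (hR : ∀ y, φ y ≠ 0 → ∀ i : Fin d, |y i.succ| ≤ R - 1) :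
    |ξ φ| ≤ ∑ m : Fin d → Fin (2 * R), ∑ j : Fin d → Fin N,
      |ξ (localize d N (fun i => ((j i : ℕ) : ℤ))
        fun y => φ (y + Fin.cons (0 : ℝ) fun i => ((((m i : ℕ) : ℤ) - R : ℤ) : ℝ)))| := by
  set v : (Fin d → Fin (2 * R)) → Fin (d + 1) → ℝ :=
    fun m => Fin.cons (0 : ℝ) fun i => ((((m i : ℕ) : ℤ) - R : ℤ) : ℝ) with hv
  set g : (Fin d → Fin (2 * R)) → (Fin d → Fin N) → (Fin (d + 1) → ℝ) → ℝ := fun m j =>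
    localize d N (fun i => ((j i : ℕ) : ℤ)) fun y => φ (y + v m) with hg
  have hgt : ∀ m j, IsTest d r (S1 d T) (g m j) := fun m j =>
    (hφ.translate (v := v m) rfl).localize N _
  set f : (Fin d → Fin (2 * R)) × (Fin d → Fin N) → (Fin (d + 1) → ℝ) → ℝ :=
    fun q y => g q.1 q.2 (y - v q.1) with hf
  have hft : ∀ q, IsTest d r (S1 d T) (f q) := fun q => by
    have h := (hgt q.1 q.2).translate (v := -v q.1) (by simp [hv])
    simpa only [hf, sub_eq_add_neg] using h
  have hfξ : ∀ q, ξ (f q) = ξ (g q.1 q.2) := fun q =>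
    hper (fun i => ((q.1 i : ℕ) : ℤ) - R) _ (hgt q.1 q.2)
  have hsum : (fun y => φ y * plateau ((N : ℝ) ^ 2 * y 0)) = ∑ q, f q := by
    ext y
    rw [Finset.sum_apply, Fintype.sum_prod_type]
    simp only [hf, hg, localize, sub_add_cancel, ← Finset.mul_sum]
    by_cases hy : φ y = 0
    · simp [hy]
    · rw [sum_sum_cellCut hN (hR y hy)]
  rw [eq_mul_plateau hN hlin hzero hφ, hsum,
    (hlin.map_sum Finset.univ f fun q _ => hft q).2, ← Fintype.sum_prod_type']
  exact (Finset.abs_sum_le_sum_abs _ _).trans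
    (Finset.sum_le_sum fun q _ => le_of_eq (by rw [hfξ q]))

/-- uniqueness part of Lemma 5.11, case ν < 0.  Let ν < 0 with
ν > -2(1 - 1/p).  If ξ ∈ 𝓑^(ν,T)_p (a periodic linear functional on test functions
supported in (-∞,T) × ℝ^d with the finite weighted norm) vanishes on every test function
supported in ((-∞,0) ∪ (0,T)) × ℝ^d, then ξ vanishes on every test function supported in
(-∞,T) × ℝ^d. -/
theorem stmt8 (d : ℕ) (hd : 1 ≤ d) (T : ℝ) (hT : 0 < T)
    (p : ENNReal) (hp : 1 ≤ p) (r : ℕ) (hr : 0 < r)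
    (ν : ℝ) (hν : ν < 0) (hν' : -2 * (1 - 1 / p).toReal < ν)
    (ξ : ((Fin (d + 1) → ℝ) → ℝ) → ℝ)
    (hlin : LinOn d r (S1 d T) ξ)
    (hmem : MemBnu d r p ν T ξ)
    (hzero : ∀ φ, IsTest d r (S1 d T) φ → tsupport φ ⊆ S0 d T → ξ φ = 0) :
    ∀ φ, IsTest d r (S1 d T) φ → ξ φ = 0 := by
  intro φ hφ
  obtain ⟨R, hR⟩ : ∃ R : ℕ, ∀ y, φ y ≠ 0 → ∀ i : Fin d, |y i.succ| ≤ R - 1 := by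
    obtain ⟨K, hK⟩ := hφ.2.1.isCompact.isBounded.exists_norm_le
    obtain ⟨R, hR⟩ := exists_nat_ge (K + 1)
    refine ⟨R, fun y hy i => ?_⟩
    have h1 := hK y (subset_tsupport φ hy)
    have h2 : |y i.succ| ≤ ‖y‖ := norm_le_pi_norm y i.succ
    linarith
  set v : (Fin d → Fin (2 * R)) → Fin (d + 1) → ℝ :=
    fun m => Fin.cons (0 : ℝ) fun i => ((((m i : ℕ) : ℤ) - R : ℤ) : ℝ) with hv
  choose C hC using fun m : Fin d → Fin (2 * R) =>
    exists_sum_localize_le hT hp hlin hmem (hφ.translate (v := v m) rfl)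
  have hle : ∀ᶠ N : ℕ in atTop,
      |ξ φ| ≤ (∑ m, C m) * (N : ℝ)⁻¹ ^ (2 * (1 - 1 / p).toReal + ν) := by
    filter_upwards [eventually_all.2 hC, eventually_gt_atTop 0] with N hN hN0
    rw [Finset.sum_mul]
    exact (abs_le_sum_localize hN0 hlin hmem.1 hzero hφ hR).trans
      (Finset.sum_le_sum fun m _ => hN m)
  have hpos : 0 < 2 * (1 - 1 / p).toReal + ν := by linarith
  have hlim : Tendsto (fun N : ℕ => (∑ m, C m) * (N : ℝ)⁻¹ ^ (2 * (1 - 1 / p).toReal + ν)) atTop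
      (𝓝 ((∑ m, C m) * 0 ^ (2 * (1 - 1 / p).toReal + ν))) :=
    ((tendsto_natCast_atTop_atTop.inv_tendsto_atTop).rpow_const (Or.inr hpos.le)).const_mul _
  rw [Real.zero_rpow hpos.ne', mul_zero] at hlim
  exact abs_nonpos_iff.1 (ge_of_tendsto hlim hle)
end
end

section
/- Suppose the family (R_n)_{n\ge 0} satisfies Assumption R with parameter \beta \ge 0. Then for each coordinate i \in \{0,1,2,3\} there exists C > 0 such that for every \xi \in \mathbb{R}^4\setminus\{0\} one has \sum_{n\ge 0} |\partial_{\xi_i}\hat{R}_n(\xi)| \le C\,|\xi|_s^{-s_i}; in particular \hat{R} = \sum_n\hat{R}_n satisfies |\partial_{\xi_i}\hat{R}(\xi)| \le C\,|\xi|_s^{-s_i} for \xi \ne 0. -/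
open MeasureTheory Filter Topology

noncomputable section

/-- Parabolic scaling exponents s = (2,1,1,1). -/
def sExp : Fin 4 → ℕ := ![2, 1, 1, 1]

/-- Parabolically scaled norm |z|_s = max_i |z_i|^(1/s_i). -/
def snorm4 (z : Fin 4 → ℝ) : ℝ := ⨆ i, |z i| ^ ((sExp i : ℝ)⁻¹)

/-- Scaling action l · z = (l^(s_i) z_i)_i. -/
def scl (l : ℝ) (z : Fin 4 → ℝ) : Fin 4 → ℝ := fun i => l ^ (sExp i) * z i

/-- Scaled size |k|_s = ∑ s_i k_i of a multi-index. -/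
def ksize (k : Fin 4 → ℕ) : ℝ := ∑ i, (sExp i : ℝ) * (k i : ℝ)

/-- Partial derivative in direction i. -/
def pderiv1 (i : Fin 4) (f : (Fin 4 → ℝ) → ℝ) : (Fin 4 → ℝ) → ℝ :=
  fun z => fderiv ℝ f z (Pi.single i 1)

/-- Iterated partial derivative ∂^k. -/
def pderivM (k : Fin 4 → ℕ) (f : (Fin 4 → ℝ) → ℝ) : (Fin 4 → ℝ) → ℝ :=
  ((pderiv1 0)^[k 0] ∘ (pderiv1 1)^[k 1] ∘ (pderiv1 2)^[k 2] ∘ (pderiv1 3)^[k 3]) f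

/-- Assumption R from the paper: the R_n are even smooth functions, R_n is supported in a
parabolic ball of radius C₀ 2^(-n), the derivative ∂^k R_n is bounded by
C_k 2^(n(|s| + |k|_s - β)) (with |s| = 5), and if β = 0 then R_n integrates to zero
for n ≥ 1. -/
structure AssumptionR (R : ℕ → (Fin 4 → ℝ) → ℝ) (β : ℝ) : Prop where
  beta_nonneg : 0 ≤ β
  even : ∀ n z, R n (-z) = R n z
  smooth : ∀ n, ContDiff ℝ (⊤ : ℕ∞) (R n)
  support : ∃ C0 > 0, ∀ n z, R n z ≠ 0 → snorm4 z ≤ C0 * (2 : ℝ) ^ (-(n : ℝ))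
  deriv_bound : ∀ k : Fin 4 → ℕ, ∃ Ck > 0, ∀ n z,
    |pderivM k (R n) z| ≤ Ck * (2 : ℝ) ^ ((n : ℝ) * (5 + ksize k - β))
  mean_zero : β = 0 → ∀ n, 1 ≤ n → (∫ z, R n z) = 0

/-- Fourier transform on ℝ⁴ with convention e^(-i⟨ξ,z⟩). -/
def ft (f : (Fin 4 → ℝ) → ℝ) (ξ : Fin 4 → ℝ) : ℂ :=
  ∫ z : Fin 4 → ℝ, Complex.exp (-Complex.I * ((∑ i, ξ i * z i : ℝ) : ℂ)) * (f z : ℂ)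

/-- The parabolic annulus A_n^C. -/
def AnC (C : ℝ) (n : ℕ) : Set (Fin 4 → ℝ) :=
  {ξ | C⁻¹ * 2 ^ n ≤ snorm4 ξ ∧ snorm4 ξ ≤ C * 2 ^ n}

/-- The set B_n^C. -/
def BnC (C : ℝ) (n : ℕ) : Set ((Fin 4 → ℝ) × (Fin 4 → ℝ)) :=
  {p | p.1 ∈ AnC C n ∧ p.2 ∈ AnC C n ∧ p.1 + p.2 ∈ AnC C n}

/-- Integration of a nonnegative function against the measure m̂, given by
(1/2π) ∫ dξ₀ ∑_(k ∈ ℤ³) f(ξ₀, 2πk₁, 2πk₂, 2πk₃). -/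
def mIntegral (f : (Fin 4 → ℝ) → ENNReal) : ENNReal :=
  ENNReal.ofReal (1 / (2 * Real.pi)) *
    ∫⁻ t : ℝ, ∑' k : Fin 3 → ℤ, f (Fin.cons t (fun j => 2 * Real.pi * (k j : ℝ)))


/-- The linear form `b ↦ ∑ i, a i * b i`. -/
def dotCLM (a : Fin 4 → ℝ) : (Fin 4 → ℝ) →L[ℝ] ℝ :=
  ∑ i, a i • ContinuousLinearMap.proj (R := ℝ) (φ := fun _ : Fin 4 => ℝ) i

lemma dotCLM_apply (a b : Fin 4 → ℝ) : dotCLM a b = ∑ i, a i * b i := by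
  simp [dotCLM]

lemma dotCLM_single (a : Fin 4 → ℝ) (i : Fin 4) : dotCLM a (Pi.single i 1) = a i := by
  simp [dotCLM_apply, Pi.single_apply]

/-- The oscillating kernel `e^(-i⟨a,b⟩)`. -/
def phase (a b : Fin 4 → ℝ) : ℂ := Complex.exp (-Complex.I * ((∑ i, a i * b i : ℝ) : ℂ))

lemma phase_comm (a b : Fin 4 → ℝ) : phase a b = phase b a := by
  simp only [phase, mul_comm]

lemma norm_phase (a b : Fin 4 → ℝ) : ‖phase a b‖ = 1 := by
  rw [phase, neg_mul, ← mul_neg, mul_comm, ← Complex.ofReal_neg, Complex.norm_exp_ofReal_mul_I]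

lemma ft_eq_integral_phase (f : (Fin 4 → ℝ) → ℝ) (ξ : Fin 4 → ℝ) :
    ft f ξ = ∫ z, phase ξ z * (f z : ℂ) := rfl

/-- The derivative of the kernel in its second argument. -/
def phaseDeriv (a b : Fin 4 → ℝ) : (Fin 4 → ℝ) →L[ℝ] ℂ :=
  (phase a b * -Complex.I) • Complex.ofRealCLM.comp (dotCLM a)

lemma hasFDerivAt_phase (a b : Fin 4 → ℝ) : HasFDerivAt (phase a) (phaseDeriv a b) b := by
  have h1 : HasFDerivAt (fun b => Complex.ofRealCLM (dotCLM a b))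
      (Complex.ofRealCLM.comp (dotCLM a)) b :=
    (Complex.ofRealCLM.comp (dotCLM a)).hasFDerivAt
  have h2 := (h1.const_mul (-Complex.I)).cexp
  simp only [Complex.ofRealCLM_apply, dotCLM_apply] at h2
  rw [smul_smul] at h2
  exact h2

lemma phaseDeriv_single (a b : Fin 4 → ℝ) (i : Fin 4) :
    phaseDeriv a b (Pi.single i 1) = phase a b * -Complex.I * a i := by
  simp [phaseDeriv, dotCLM_single]

@[fun_prop]
lemma continuous_dotCLM : Continuous dotCLM := by
  unfold dotCLM; fun_prop

@[fun_prop]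
lemma continuous_phase (a : Fin 4 → ℝ) : Continuous (phase a) := by
  unfold phase; fun_prop

lemma integrable_phase_mul {f : (Fin 4 → ℝ) → ℝ} (hf : Continuous f) (hs : HasCompactSupport f)
    (ξ : Fin 4 → ℝ) : Integrable fun z => phase ξ z * (f z : ℂ) := by
  refine Continuous.integrable_of_hasCompactSupport (by fun_prop) ?_
  exact HasCompactSupport.mul_left (hs.comp_left (g := ((↑) : ℝ → ℂ)) Complex.ofReal_zero)

lemma hasFDerivAt_ft {f : (Fin 4 → ℝ) → ℝ} (hf : Continuous f) (hs : HasCompactSupport f)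
    (ξ : Fin 4 → ℝ) :
    HasFDerivAt (ft f) (∫ z, (f z : ℂ) • phaseDeriv z ξ) ξ ∧
      Integrable fun z => (f z : ℂ) • phaseDeriv z ξ := by
  have hb : Integrable fun z => ‖f z‖ * ‖Complex.ofRealCLM.comp (dotCLM z)‖ := by
    refine Continuous.integrable_of_hasCompactSupport (by fun_prop) ?_
    exact hs.norm.mul_right
  have hm : Continuous fun z => (f z : ℂ) • phaseDeriv z ξ := by
    unfold phaseDeriv
    simp only [phase_comm _ ξ]
    fun_prop
  have hle : ∀ z ζ, ‖(f z : ℂ) • phaseDeriv z ζ‖ ≤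
      ‖f z‖ * ‖Complex.ofRealCLM.comp (dotCLM z)‖ := by
    intro z ζ
    rw [phaseDeriv, norm_smul, norm_smul, norm_mul, norm_phase, norm_neg, Complex.norm_I,
      Complex.norm_real]
    simp
  refine ⟨?_, hb.mono' hm.aestronglyMeasurable (.of_forall fun z => hle z ξ)⟩
  refine hasFDerivAt_integral_of_dominated_of_fderiv_le (s := Set.univ)
    (F := fun ζ z => phase ζ z * (f z : ℂ)) (F' := fun ζ z => (f z : ℂ) • phaseDeriv z ζ)
    Filter.univ_mem ?_ (integrable_phase_mul hf hs ξ) hm.aestronglyMeasurable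
    (.of_forall fun z ζ _ => hle z ζ) hb (.of_forall fun z ζ _ => ?_)
  · exact .of_forall fun ζ => (integrable_phase_mul hf hs ζ).aestronglyMeasurable
  · simp only [phase_comm _ z]
    exact (hasFDerivAt_phase z ζ).mul_const _

lemma fderiv_ft_single {f : (Fin 4 → ℝ) → ℝ} (hf : Continuous f) (hs : HasCompactSupport f)
    (ξ : Fin 4 → ℝ) (i : Fin 4) :
    fderiv ℝ (ft f) ξ (Pi.single i 1) = -Complex.I * ft (fun z => z i * f z) ξ := by
  obtain ⟨h, hi⟩ := hasFDerivAt_ft hf hs ξ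
  rw [h.fderiv, ContinuousLinearMap.integral_apply hi, ft_eq_integral_phase, ← integral_const_mul]
  congr 1 with z
  rw [_root_.smul_apply, phaseDeriv_single, phase_comm z ξ]
  push_cast
  rw [smul_eq_mul]
  ring

lemma ft_pderiv1 {f : (Fin 4 → ℝ) → ℝ} (hf : ContDiff ℝ 1 f) (hs : HasCompactSupport f)
    (ξ : Fin 4 → ℝ) (j : Fin 4) :
    ft (pderiv1 j f) ξ = Complex.I * ξ j * ft f ξ := by
  have hd : ∀ z, HasFDerivAt (fun z => (f z : ℂ)) (Complex.ofRealCLM.comp (fderiv ℝ f z)) z :=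
    fun z => Complex.ofRealCLM.hasFDerivAt.comp z
      (hf.differentiable one_ne_zero z).hasFDerivAt
  have hc : Continuous (pderiv1 j f) :=
    (hf.continuous_fderiv one_ne_zero).clm_apply continuous_const
  have hcs : HasCompactSupport (pderiv1 j f) := hs.fderiv_apply ℝ _
  have hfd : ∀ z, fderiv ℝ (fun z => (f z : ℂ)) z (Pi.single j 1) = (pderiv1 j f z : ℂ) :=
    fun z => by rw [(hd z).fderiv]; rfl
  have hpd : ∀ z, fderiv ℝ (phase ξ) z (Pi.single j 1) * (f z : ℂ) =
      (-Complex.I * ξ j) * (phase ξ z * (f z : ℂ)) := fun z => by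
    rw [(hasFDerivAt_phase ξ z).fderiv, phaseDeriv_single]; ring
  have key := integral_mul_fderiv_eq_neg_fderiv_mul_of_integrable (𝕜 := ℂ) (μ := volume)
    (f := phase ξ) (g := fun z => (f z : ℂ)) (v := Pi.single j 1)
    (by simp only [hpd]; exact (integrable_phase_mul hf.continuous hs ξ).const_mul _)
    (by simp only [hfd]; exact integrable_phase_mul hc hcs ξ)
    (integrable_phase_mul hf.continuous hs ξ)
    (fun z _ => (hasFDerivAt_phase ξ z).differentiableAt)
    (fun z _ => (hd z).differentiableAt)
  simp only [hfd, hpd, integral_const_mul] at key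
  rw [ft_eq_integral_phase, key, ft_eq_integral_phase]
  ring

lemma contDiff_pderiv1 {f : (Fin 4 → ℝ) → ℝ} (hf : ContDiff ℝ (⊤ : ℕ∞) f) (j : Fin 4) :
    ContDiff ℝ (⊤ : ℕ∞) (pderiv1 j f) :=
  (hf.fderiv_right (m := (⊤ : ℕ∞)) (by simp)).clm_apply contDiff_const

lemma norm_ft_iterate_pderiv1 {f : (Fin 4 → ℝ) → ℝ} (hf : ContDiff ℝ (⊤ : ℕ∞) f)
    (hs : HasCompactSupport f) (ξ : Fin 4 → ℝ) (j : Fin 4) (m : ℕ) :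
    ‖ft ((pderiv1 j)^[m] f) ξ‖ = |ξ j| ^ m * ‖ft f ξ‖ := by
  induction m generalizing f with
  | zero => simp
  | succ m ih =>
    rw [Function.iterate_succ_apply, ih (contDiff_pderiv1 hf j) (hs.fderiv_apply ℝ _),
      ft_pderiv1 (hf.of_le (by simp)) hs]
    simp [pow_succ, mul_assoc]

lemma pderiv1_coord_mul {f : (Fin 4 → ℝ) → ℝ} (hf : Differentiable ℝ f) (i j : Fin 4)
    (z : Fin 4 → ℝ) :
    pderiv1 j (fun z => z i * f z) z = (if i = j then 1 else 0) * f z + z i * pderiv1 j f z := by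
  have h := (hasFDerivAt_apply (𝕜 := ℝ) i z).mul (hf z).hasFDerivAt
  have h' : fderiv ℝ (fun z => z i * f z) z = _ := h.fderiv
  simp only [pderiv1, h']
  simp [Pi.single_apply]
  ring

lemma pderiv1_const_mul_add {f g : (Fin 4 → ℝ) → ℝ} (hf : Differentiable ℝ f)
    (hg : Differentiable ℝ g) (c : ℝ) (j : Fin 4) (z : Fin 4 → ℝ) :
    pderiv1 j (fun z => c * f z + g z) z = c * pderiv1 j f z + pderiv1 j g z := by
  have h := ((hf z).hasFDerivAt.const_mul c).add (hg z).hasFDerivAt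
  have h' : fderiv ℝ (fun z => c * f z + g z) z = _ := h.fderiv
  simp [pderiv1, h']

lemma iterate_pderiv1_coord_mul {f : (Fin 4 → ℝ) → ℝ} (hf : ContDiff ℝ (⊤ : ℕ∞) f) (i j : Fin 4)
    (m : ℕ) (z : Fin 4 → ℝ) :
    (pderiv1 j)^[m + 1] (fun z => z i * f z) z =
      (m + 1) * (if i = j then 1 else 0) * (pderiv1 j)^[m] f z +
        z i * (pderiv1 j)^[m + 1] f z := by
  induction m generalizing z with
  | zero => simpa using pderiv1_coord_mul (hf.differentiable (by simp)) i j z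
  | succ m ih =>
    have hc : ∀ m, ContDiff ℝ (⊤ : ℕ∞) ((pderiv1 j)^[m] f) := fun m => by
      induction m with
      | zero => exact hf
      | succ m ih => rw [Function.iterate_succ_apply']; exact contDiff_pderiv1 ih j
    rw [Function.iterate_succ_apply', funext ih]
    have h1 := (hc m).differentiable (by simp)
    have h2 := (hc (m + 1)).differentiable (by simp)
    have h3 : Differentiable ℝ fun z : Fin 4 → ℝ => z i * (pderiv1 j)^[m + 1] f z :=
      (differentiable_apply i).mul h2
    rw [pderiv1_const_mul_add h1 h3, pderiv1_coord_mul h2 i j z]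
    simp only [Function.iterate_succ_apply']
    push_cast
    ring

lemma pderiv1_eq_zero_of_notMem {K : Set (Fin 4 → ℝ)} (hK : IsClosed K) {f : (Fin 4 → ℝ) → ℝ}
    (hf : ∀ z ∉ K, f z = 0) (j : Fin 4) : ∀ z ∉ K, pderiv1 j f z = 0 := by
  intro z hz
  have : f =ᶠ[𝓝 z] fun _ => 0 := by
    filter_upwards [hK.isOpen_compl.mem_nhds hz] with w hw using hf w hw
  simp [pderiv1, this.fderiv_eq]

lemma iterate_pderiv1_eq_zero_of_notMem {K : Set (Fin 4 → ℝ)} (hK : IsClosed K)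
    {f : (Fin 4 → ℝ) → ℝ} (hf : ∀ z ∉ K, f z = 0) (j : Fin 4) (m : ℕ) :
    ∀ z ∉ K, (pderiv1 j)^[m] f z = 0 := by
  induction m with
  | zero => exact hf
  | succ m ih =>
    rw [Function.iterate_succ_apply']
    exact pderiv1_eq_zero_of_notMem hK ih j

/-- The closed box `{z | |z i| ≤ r ^ s_i}`. -/
def sBox (r : ℝ) : Set (Fin 4 → ℝ) := Set.Icc (fun i => -r ^ sExp i) (fun i => r ^ sExp i)

lemma mem_sBox {r : ℝ} {z : Fin 4 → ℝ} : z ∈ sBox r ↔ ∀ i, |z i| ≤ r ^ sExp i := by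
  simp only [sBox, Set.mem_Icc, Pi.le_def, abs_le, forall_and]

lemma volume_sBox {r : ℝ} (hr : 0 ≤ r) : volume (sBox r) = ENNReal.ofReal (16 * r ^ 5) := by
  rw [sBox, Real.volume_Icc_pi, ← ENNReal.ofReal_prod_of_nonneg]
  · congr 1
    simp only [Fin.prod_univ_four, sExp]
    simp
    ring
  · intro i _
    have : 0 ≤ r ^ sExp i := by positivity
    linarith

lemma norm_ft_le {f : (Fin 4 → ℝ) → ℝ} {r M : ℝ} (hr : 0 ≤ r) (h0 : ∀ z ∉ sBox r, f z = 0)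
    (hM : ∀ z ∈ sBox r, |f z| ≤ M) (ξ : Fin 4 → ℝ) : ‖ft f ξ‖ ≤ M * (16 * r ^ 5) := by
  rw [ft_eq_integral_phase, ← setIntegral_eq_integral_of_forall_compl_eq_zero (s := sBox r)
    (fun z hz => by simp [h0 z hz])]
  have := norm_setIntegral_le_of_norm_le_const (μ := volume) (s := sBox r) (C := M)
    (f := fun z => phase ξ z * (f z : ℂ))
    (by rw [volume_sBox hr]; exact ENNReal.ofReal_lt_top) (fun z hz => by
      rw [norm_mul, norm_phase, one_mul, Complex.norm_real]; exact hM z hz)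
  rwa [measureReal_def, volume_sBox hr, ENNReal.toReal_ofReal (by positivity)] at this

lemma sExp_pos (i : Fin 4) : 0 < sExp i := by fin_cases i <;> simp [sExp]

lemma sExp_le_two (i : Fin 4) : sExp i ≤ 2 := by fin_cases i <;> simp [sExp]

lemma rpow_inv_sExp_pow (x : ℝ) (i : Fin 4) : (|x| ^ ((sExp i : ℝ)⁻¹)) ^ sExp i = |x| :=
  Real.rpow_inv_natCast_pow (abs_nonneg x) (sExp_pos i).ne'

lemma mem_sBox_of_snorm4_le {r : ℝ} {z : Fin 4 → ℝ} (h : snorm4 z ≤ r) : z ∈ sBox r := by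
  refine mem_sBox.2 fun i => ?_
  rw [← rpow_inv_sExp_pow (z i) i]
  gcongr
  exact (le_ciSup (f := fun i => |z i| ^ ((sExp i : ℝ)⁻¹)) (Set.finite_range _).bddAbove i).trans h

lemma exists_abs_eq_snorm4_pow (ξ : Fin 4 → ℝ) : ∃ j, |ξ j| = snorm4 ξ ^ sExp j := by
  obtain ⟨j, hj⟩ := exists_eq_ciSup_of_finite (f := fun i => |ξ i| ^ ((sExp i : ℝ)⁻¹))
  exact ⟨j, by rw [snorm4, ← hj, rpow_inv_sExp_pow]⟩

lemma snorm4_pos {ξ : Fin 4 → ℝ} (h : ξ ≠ 0) : 0 < snorm4 ξ := by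
  obtain ⟨i, hi⟩ := Function.ne_iff.1 h
  exact (Real.rpow_pos_of_pos (abs_pos.2 hi) _).trans_le
    (le_ciSup (f := fun i => |ξ i| ^ ((sExp i : ℝ)⁻¹)) (Set.finite_range _).bddAbove i)

lemma pderivM_single (j : Fin 4) (m : ℕ) (f : (Fin 4 → ℝ) → ℝ) :
    pderivM (Pi.single j m) f = (pderiv1 j)^[m] f := by
  fin_cases j <;> simp [pderivM]

lemma ksize_single (j : Fin 4) (m : ℕ) : ksize (Pi.single j m) = sExp j * m := by
  simp only [ksize, Pi.single_apply]
  simp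

/-- The two-sided geometric series over dyadic scales is bounded independently of the centre. -/
lemma summable_min_dyadic {X : ℝ} (hX : 0 < X) :
    Summable (fun n : ℕ => min (2 ^ n / X) (X / 2 ^ n)) ∧
      ∑' n : ℕ, min (2 ^ n / X) (X / 2 ^ n) ≤ 4 := by
  have hs : Summable fun n : ℕ => X * (1 / 2 : ℝ) ^ n := summable_geometric_two.mul_left X
  have hle : ∀ n : ℕ, min (2 ^ n / X) (X / 2 ^ n) ≤ X * (1 / 2 : ℝ) ^ n := fun n =>
    (min_le_right _ _).trans_eq (by rw [one_div, inv_pow, div_eq_mul_inv])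
  have hsum : Summable (fun n : ℕ => min (2 ^ n / X) (X / 2 ^ n)) :=
    hs.of_nonneg_of_le (fun n => by positivity) hle
  refine ⟨hsum, ?_⟩
  obtain ⟨N, hN, hN'⟩ : ∃ N : ℕ, X ≤ 2 ^ N ∧ (2 : ℝ) ^ N - 1 ≤ 2 * X := by
    have hex : ∃ N : ℕ, X ≤ 2 ^ N := (pow_unbounded_of_one_lt X one_lt_two).imp fun _ h => h.le
    classical
    refine ⟨Nat.find hex, Nat.find_spec hex, ?_⟩
    rcases h : Nat.find hex with _ | k
    · simp [hX.le]
    · have := Nat.find_min hex (m := k) (by omega)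
      rw [pow_succ]; linarith
  rw [← hsum.sum_add_tsum_nat_add N]
  have h1 : ∑ n ∈ Finset.range N, min ((2 : ℝ) ^ n / X) (X / 2 ^ n) ≤ 2 := by
    calc _ ≤ ∑ n ∈ Finset.range N, (2 : ℝ) ^ n / X := Finset.sum_le_sum fun n _ => min_le_left _ _
      _ = (2 ^ N - 1) / X := by
        rw [← Finset.sum_div, geom_sum_eq (by norm_num)]; norm_num
      _ ≤ 2 := by rw [div_le_iff₀ hX]; exact hN'
  have h2 : ∑' n : ℕ, min ((2 : ℝ) ^ (n + N) / X) (X / 2 ^ (n + N)) ≤ 2 := by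
    refine (((summable_nat_add_iff N).2 hsum).tsum_le_tsum (fun n => ?_)
      summable_geometric_two).trans_eq tsum_geometric_two
    refine (min_le_right _ _).trans ?_
    rw [one_div, inv_pow, div_le_iff₀ (by positivity), pow_add]
    rwa [inv_mul_cancel_left₀ (by positivity)]
  linarith

namespace AssumptionR

variable {R : ℕ → (Fin 4 → ℝ) → ℝ} {β : ℝ}

lemma exists_eq_zero_of_notMem_sBox (hR : AssumptionR R β) :
    ∃ C0 > 0, ∀ n : ℕ, ∀ z ∉ sBox (C0 / 2 ^ n), R n z = 0 := by
  obtain ⟨C0, hC0, h⟩ := hR.support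
  refine ⟨C0, hC0, fun n z hz => ?_⟩
  by_contra hne
  refine hz (mem_sBox_of_snorm4_le ((h n z hne).trans_eq ?_))
  rw [Real.rpow_neg zero_le_two, Real.rpow_natCast, div_eq_mul_inv]

lemma hasCompactSupport (hR : AssumptionR R β) (n : ℕ) : HasCompactSupport (R n) := by
  obtain ⟨C0, _, h⟩ := hR.exists_eq_zero_of_notMem_sBox
  exact HasCompactSupport.intro isCompact_Icc (h n)

lemma exists_iterate_pderiv1_le (hR : AssumptionR R β) (j : Fin 4) (m : ℕ) :
    ∃ D > 0, ∀ n z, |(pderiv1 j)^[m] (R n) z| ≤ D * ((2 : ℝ) ^ n) ^ (5 + sExp j * m) := by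
  obtain ⟨D, hD, h⟩ := hR.deriv_bound (Pi.single j m)
  refine ⟨D, hD, fun n z => ?_⟩
  rw [← pderivM_single]
  refine (h n z).trans ?_
  gcongr
  rw [← pow_mul, ← Real.rpow_natCast, ksize_single]
  refine Real.rpow_le_rpow_of_exponent_le one_le_two ?_
  push_cast
  gcongr
  linarith [hR.beta_nonneg]

lemma fderiv_ft_single (hR : AssumptionR R β) (n : ℕ) (ξ : Fin 4 → ℝ) (i : Fin 4) :
    ‖fderiv ℝ (ft (R n)) ξ (Pi.single i 1)‖ = ‖ft (fun z => z i * R n z) ξ‖ := by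
  rw [_root_.fderiv_ft_single (hR.smooth n).continuous (hR.hasCompactSupport n)]
  simp

lemma exists_norm_fderiv_ft_mul_le (hR : AssumptionR R β) (i : Fin 4) :
    ∃ A > 0, ∀ (n : ℕ) (ξ : Fin 4 → ℝ),
      ‖fderiv ℝ (ft (R n)) ξ (Pi.single i 1)‖ * (2 ^ n) ^ sExp i ≤ A := by
  obtain ⟨C0, hC0, h0⟩ := hR.exists_eq_zero_of_notMem_sBox
  obtain ⟨D, hD, h⟩ := hR.exists_iterate_pderiv1_le 0 0
  refine ⟨16 * D * C0 ^ 5 * C0 ^ sExp i, by positivity, fun n ξ => ?_⟩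
  have hb : (0 : ℝ) < 2 ^ n := by positivity
  rw [hR.fderiv_ft_single]
  have key := norm_ft_le (f := fun z => z i * R n z) (r := C0 / 2 ^ n)
    (M := (C0 / 2 ^ n) ^ sExp i * (D * ((2 : ℝ) ^ n) ^ 5)) (by positivity)
    (fun z hz => by simp [h0 n z hz]) (fun z hz => by
      rw [abs_mul]
      exact mul_le_mul (mem_sBox.1 hz i) (by simpa using h n z) (abs_nonneg _) (by positivity)) ξ
  refine (mul_le_mul_of_nonneg_right key (by positivity)).trans_eq ?_
  generalize (2 : ℝ) ^ n = b at hb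
  rw [div_pow, div_pow]
  field_simp

lemma exists_pow_mul_norm_fderiv_ft_le (hR : AssumptionR R β) (i j : Fin 4) :
    ∃ A > 0, ∀ (n : ℕ) (ξ : Fin 4 → ℝ),
      |ξ j| ^ 3 * (‖fderiv ℝ (ft (R n)) ξ (Pi.single i 1)‖ * (2 ^ n) ^ sExp i) ≤
        A * (2 ^ n) ^ (3 * sExp j) := by
  obtain ⟨C0, hC0, h0⟩ := hR.exists_eq_zero_of_notMem_sBox
  obtain ⟨D, hD, h⟩ := hR.exists_iterate_pderiv1_le j 3
  obtain ⟨E, hE, h'⟩ := hR.exists_iterate_pderiv1_le j 2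
  refine ⟨48 * E * C0 ^ 5 + 16 * D * C0 ^ 5 * C0 ^ sExp i, by positivity, fun n ξ => ?_⟩
  have hb : (0 : ℝ) < 2 ^ n := by positivity
  have hsm : ContDiff ℝ (⊤ : ℕ∞) (fun z : Fin 4 → ℝ => z i * R n z) :=
    (contDiff_apply ℝ ℝ i).mul (hR.smooth n)
  have hz0 : ∀ z ∉ sBox (C0 / 2 ^ n), z i * R n z = 0 := fun z hz => by simp [h0 n z hz]
  rw [hR.fderiv_ft_single, ← mul_assoc, ← norm_ft_iterate_pderiv1 hsm
    (HasCompactSupport.intro isCompact_Icc hz0)]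
  have key := norm_ft_le (r := C0 / 2 ^ n)
    (M := 3 * (if i = j then 1 else 0) * (E * ((2 : ℝ) ^ n) ^ (5 + sExp j * 2)) +
      (C0 / 2 ^ n) ^ sExp i * (D * ((2 : ℝ) ^ n) ^ (5 + sExp j * 3))) (by positivity)
    (iterate_pderiv1_eq_zero_of_notMem isClosed_Icc hz0 j 3) (fun z hz => by
      rw [iterate_pderiv1_coord_mul (hR.smooth n) i j 2]
      refine (abs_add_le _ _).trans (add_le_add ?_ ?_)
      · rw [abs_mul, abs_of_nonneg (by positivity)]
        refine (mul_le_mul_of_nonneg_left (h' n z) (by positivity)).trans_eq ?_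
        norm_num
      · rw [abs_mul]
        exact mul_le_mul (mem_sBox.1 hz i) (h n z) (abs_nonneg _) (by positivity)) ξ
  refine (mul_le_mul_of_nonneg_right key (by positivity)).trans ?_
  generalize (2 : ℝ) ^ n = b at hb
  rw [div_pow, div_pow]
  by_cases hij : i = j
  · subst hij
    simp only [if_true]
    apply le_of_eq
    field_simp
    ring
  · simp only [if_neg hij, mul_zero, zero_mul, zero_add]
    have : 0 ≤ 48 * E * C0 ^ 5 * b ^ (3 * sExp j) := by positivity
    rw [add_mul]
    refine le_trans (le_of_eq ?_) (le_add_of_nonneg_left this)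
    field_simp
    ring

lemma summable_ft_zero (hR : AssumptionR R β) : Summable fun n => ft (R n) 0 := by
  have hft : ∀ n, ft (R n) 0 = ((∫ z, R n z : ℝ) : ℂ) := fun n => by
    simp [ft, integral_complex_ofReal]
  rcases hR.beta_nonneg.eq_or_lt with hβ | hβ
  · refine summable_of_ne_finset_zero (s := {0}) fun n hn => ?_
    rw [hft, hR.mean_zero hβ.symm n (Nat.one_le_iff_ne_zero.2 (by simpa using hn))]
    simp
  · obtain ⟨C0, hC0, h0⟩ := hR.exists_eq_zero_of_notMem_sBox
    obtain ⟨D, hD, h⟩ := hR.deriv_bound 0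
    have hq : (2 : ℝ) ^ (-β) < 1 := Real.rpow_lt_one_of_one_lt_of_neg one_lt_two (neg_lt_zero.2 hβ)
    refine Summable.of_norm_bounded (g := fun n : ℕ => 16 * D * C0 ^ 5 * ((2 : ℝ) ^ (-β)) ^ n)
      ((summable_geometric_of_lt_one (by positivity) hq).mul_left _) fun n => ?_
    refine (norm_ft_le (by positivity) (h0 n) (fun z _ => by
      simpa [pderivM, ksize] using h n z) 0).trans_eq ?_
    have : (2 : ℝ) ^ ((n : ℝ) * (5 - β)) = (2 ^ n) ^ 5 * ((2 : ℝ) ^ (-β)) ^ n := by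
      rw [← Real.rpow_natCast (2 ^ (-β)), ← Real.rpow_mul zero_le_two, ← pow_mul,
        ← Real.rpow_natCast, ← Real.rpow_add two_pos]
      push_cast
      ring_nf
    rw [this, div_pow]
    field_simp

end AssumptionR

lemma le_mul_min_of_mul_pow_le {A t y : ℝ} {s p : ℕ} (hA : 0 ≤ A) (ht : 0 < t) (hy : 0 ≤ y)
    (hs : 1 ≤ s) (hs' : s ≤ 2) (hp : 3 ≤ p) (h1 : y * t ^ s ≤ A) (h2 : y * t ^ s ≤ A * t ^ p) :
    y ≤ A * min t t⁻¹ := by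
  rw [mul_min_of_nonneg _ _ hA, le_min_iff]
  rcases le_total 1 t with h | h
  · have : y * t ≤ A := (mul_le_mul_of_nonneg_left (le_self_pow₀ h (by omega)) hy).trans h1
    have h3 : y ≤ A * t⁻¹ := by rwa [← div_eq_mul_inv, le_div_iff₀ ht]
    exact ⟨h3.trans (by gcongr; exact (inv_le_one_of_one_le₀ h).trans h), h3⟩
  · have : y * t ^ 2 ≤ A * t * t ^ 2 := by
      calc y * t ^ 2 ≤ y * t ^ s :=
            mul_le_mul_of_nonneg_left (pow_le_pow_of_le_one ht.le h hs') hy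
        _ ≤ A * t ^ p := h2
        _ ≤ A * t ^ 3 := mul_le_mul_of_nonneg_left (pow_le_pow_of_le_one ht.le h hp) hA
        _ = A * t * t ^ 2 := by ring
    have h3 : y ≤ A * t := le_of_mul_le_mul_right this (by positivity)
    exact ⟨h3, h3.trans (by gcongr; exact h.trans ((one_le_inv₀ ht).2 h))⟩

lemma norm_le_sum_norm_apply_single (L : (Fin 4 → ℝ) →L[ℝ] ℂ) :
    ‖L‖ ≤ ∑ i, ‖L (Pi.single i 1)‖ := by
  refine L.opNorm_le_bound (by positivity) fun x => ?_
  have hx : x = ∑ i, x i • Pi.single i (1 : ℝ) := by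
    ext k; simp [Finset.sum_apply, Pi.single_apply]
  conv_lhs => rw [hx, map_sum]
  rw [Finset.sum_mul]
  refine (norm_sum_le _ _).trans (Finset.sum_le_sum fun i _ => ?_)
  rw [map_smul, norm_smul, mul_comm]
  gcongr
  exact norm_le_pi_norm x i

namespace AssumptionR

variable {R : ℕ → (Fin 4 → ℝ) → ℝ} {β : ℝ}

lemma exists_norm_fderiv_ft_le_min (hR : AssumptionR R β) (i : Fin 4) :
    ∃ A > 0, ∀ ξ : Fin 4 → ℝ, ξ ≠ 0 → ∀ n : ℕ, ‖fderiv ℝ (ft (R n)) ξ (Pi.single i 1)‖ ≤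
      A * snorm4 ξ ^ (-(sExp i : ℝ)) * min (2 ^ n / snorm4 ξ) (snorm4 ξ / 2 ^ n) := by
  obtain ⟨A₀, hA₀, h₀⟩ := hR.exists_norm_fderiv_ft_mul_le i
  choose A hA h using hR.exists_pow_mul_norm_fderiv_ft_le i
  have hle : ∀ j, A j ≤ A₀ + ∑ j, A j := fun j =>
    (Finset.single_le_sum (fun j _ => (hA j).le) (Finset.mem_univ j)).trans
      (le_add_of_nonneg_left hA₀.le)
  have hsum : 0 ≤ ∑ j, A j := Finset.sum_nonneg fun j _ => (hA j).le
  refine ⟨A₀ + ∑ j, A j, by positivity, fun ξ hξ n => ?_⟩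
  have hX := snorm4_pos hξ
  obtain ⟨j, hj⟩ := exists_abs_eq_snorm4_pow ξ
  have h1 := (h₀ n ξ).trans (le_add_of_nonneg_right hsum)
  have h2 := (h j n ξ).trans (mul_le_mul_of_nonneg_right (hle j) (by positivity))
  rw [hj] at h2
  rw [Real.rpow_neg hX.le, Real.rpow_natCast]
  have hb : (0 : ℝ) < 2 ^ n := by positivity
  have ha := norm_nonneg (fderiv ℝ (ft (R n)) ξ (Pi.single i 1))
  generalize ‖fderiv ℝ (ft (R n)) ξ (Pi.single i 1)‖ = a at *
  generalize A₀ + ∑ j, A j = B at *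
  generalize (2 : ℝ) ^ n = b at *
  generalize snorm4 ξ = X at *
  have hB : 0 ≤ B := le_trans (by positivity) h1
  have hy : a * X ^ sExp i * (b / X) ^ sExp i = a * b ^ sExp i := by
    rw [div_pow]; field_simp
  have key := le_mul_min_of_mul_pow_le (A := B) (t := b / X) (y := a * X ^ sExp i) (s := sExp i)
    (p := 3 * sExp j) hB (by positivity) (by positivity) (sExp_pos i) (sExp_le_two i)
    (by have := sExp_pos j; omega) (hy.trans_le h1) (by
      rw [hy, div_pow, ← mul_div_assoc, le_div_iff₀ (by positivity)]
      refine le_of_eq_of_le ?_ h2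
      ring)
  rw [inv_div] at key
  rw [mul_right_comm, ← div_eq_mul_inv, le_div_iff₀ (by positivity)]
  exact key

lemma exists_norm_fderiv_ft_le (hR : AssumptionR R β) :
    ∃ A, ∀ (n : ℕ) (ξ : Fin 4 → ℝ), ‖fderiv ℝ (ft (R n)) ξ‖ ≤ A * (1 / 2) ^ n := by
  choose A hA h using hR.exists_norm_fderiv_ft_mul_le
  refine ⟨∑ i, A i, fun n ξ => (norm_le_sum_norm_apply_single _).trans ?_⟩
  rw [Finset.sum_mul]
  refine Finset.sum_le_sum fun i _ => ?_
  rw [one_div, inv_pow, ← div_eq_mul_inv, le_div_iff₀ (by positivity)]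
  refine le_trans ?_ (h i n ξ)
  gcongr
  exact le_self_pow₀ (one_le_pow₀ one_le_two) (sExp_pos i).ne'

lemma fderiv_tsum_ft_single (hR : AssumptionR R β) (ξ : Fin 4 → ℝ) (i : Fin 4) :
    fderiv ℝ (fun ζ => ∑' n, ft (R n) ζ) ξ (Pi.single i 1) =
      ∑' n, fderiv ℝ (ft (R n)) ξ (Pi.single i 1) := by
  obtain ⟨A, hA⟩ := hR.exists_norm_fderiv_ft_le
  have hu : Summable fun n : ℕ => A * (1 / 2 : ℝ) ^ n := summable_geometric_two.mul_left A
  rw [fderiv_tsum hu (fun n ζ => (hasFDerivAt_ft (hR.smooth n).continuous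
    (hR.hasCompactSupport n) ζ).1.differentiableAt) hA hR.summable_ft_zero]
  exact (ContinuousLinearMap.apply ℝ ℂ (Pi.single i (1 : ℝ) : Fin 4 → ℝ)).map_tsum
    (Summable.of_norm_bounded hu fun n => hA n ξ)

end AssumptionR

/-- bound (2.5) in Lemma 2.4's proof.  Under Assumption R, for each
coordinate i, ∑ₙ |∂_(ξᵢ) R̂ₙ(ξ)| ≲ |ξ|_s^(-sᵢ) for ξ ≠ 0; in particular the derivative of
R̂ = ∑ₙ R̂ₙ obeys the same bound. -/
theorem stmt11 (R : ℕ → (Fin 4 → ℝ) → ℝ) (β : ℝ) (hR : AssumptionR R β) :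
    ∀ i : Fin 4, ∃ C > 0, ∀ ξ : Fin 4 → ℝ, ξ ≠ 0 →
      Summable (fun n : ℕ => ‖fderiv ℝ (ft (R n)) ξ (Pi.single i 1)‖) ∧
      (∑' n : ℕ, ‖fderiv ℝ (ft (R n)) ξ (Pi.single i 1)‖) ≤
        C * snorm4 ξ ^ (-(sExp i : ℝ)) ∧
      ‖fderiv ℝ (fun ζ => ∑' n : ℕ, ft (R n) ζ) ξ (Pi.single i 1)‖ ≤
        C * snorm4 ξ ^ (-(sExp i : ℝ)) := by
  intro i
  obtain ⟨A, hA, h⟩ := hR.exists_norm_fderiv_ft_le_min i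
  refine ⟨A * 4, by positivity, fun ξ hξ => ?_⟩
  have hX := snorm4_pos hξ
  obtain ⟨hs, hle⟩ := summable_min_dyadic hX
  have hsum : Summable fun n : ℕ => ‖fderiv ℝ (ft (R n)) ξ (Pi.single i 1)‖ :=
    (hs.mul_left _).of_nonneg_of_le (fun n => norm_nonneg _) (h ξ hξ)
  have hbound : ∑' n : ℕ, ‖fderiv ℝ (ft (R n)) ξ (Pi.single i 1)‖ ≤
      A * 4 * snorm4 ξ ^ (-(sExp i : ℝ)) := by
    refine (hsum.tsum_le_tsum (h ξ hξ) (hs.mul_left _)).trans ?_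
    rw [tsum_mul_left, mul_right_comm]
    gcongr
  refine ⟨hsum, hbound, ?_⟩
  rw [hR.fderiv_tsum_ft_single]
  exact (norm_tsum_le_tsum_norm hsum).trans hbound
end
end
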